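/- Let n ≥ 1, let 1 ≤ a ≤ b ≤ n, let h ∈ H_{n,ϖ_a}, and let E ∈ B(ϖ_a) be a column of length a. Write t^{ℓ(u_E)} (T_{u_E⁻¹})⁻¹ h = Σ_{F ∈ B(ϖ_b)} T_{u_F} h_F with h_F ∈ H_{n,ϖ_b} (the unique parabolic decomposition). If F ∈ B(ϖ_b) is such that the two-column filling F⊗E is not semistandard (i.e. f_i > e_i for some i ∈ [a]), then h_F = 0. -/

import Mathlib

set_option maxHeartbeats 1000000

attribute [local instance] Classical.propDecidable

noncomputable section

namespace HLHecke

/-- The base ring `ℤ[t^{±1}]` of Laurent polynomials. -/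
abbrev HR : Type := LaurentPolynomial ℤ

/-- The parameter `t`. -/
def tt : HR := LaurentPolynomial.T 1

/-! ### The symmetric group on `Fin n` -/

/-- The simple transposition `s_j = (j, j+1)` (junk value `1` if out of range). -/
def sgen (n : ℕ) (j : ℕ) : Equiv.Perm (Fin n) :=
  if h : j + 1 < n then Equiv.swap ⟨j, Nat.lt_of_succ_lt h⟩ ⟨j + 1, h⟩ else 1

/-- The product `s_{i₁} ⋯ s_{i_ℓ}` of a word `l = [i₁, …, i_ℓ]`. -/
def wordProd (n : ℕ) (l : List ℕ) : Equiv.Perm (Fin n) := (l.map (sgen n)).prod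

/-- The action of `S_n` on `ℤⁿ` by permutation of coordinates. -/
def wAct (n : ℕ) (w : Equiv.Perm (Fin n)) (μ : Fin n → ℤ) : Fin n → ℤ := fun i => μ (w⁻¹ i)

/-- The standard inner product on `ℤⁿ`. -/
def ip (n : ℕ) (μ ν : Fin n → ℤ) : ℤ := ∑ i, μ i * ν i

/-- The standard basis vector `ε_i`. -/
def eps (n : ℕ) (i : Fin n) : Fin n → ℤ := fun k => if k = i then 1 else 0

/-- The simple root `α_j = ε_j − ε_{j+1}` (0-indexed: entries `j` and `j+1` of `Fin n`). -/
def alpha (n : ℕ) (j : ℕ) : Fin n → ℤ :=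
  fun i => if (i : ℕ) = j then 1 else if (i : ℕ) = j + 1 then -1 else 0

/-- The fundamental weight `ϖ_k = ε₁ + … + ε_k`. -/
def varpi (n : ℕ) (k : ℕ) : Fin n → ℤ := fun i => if (i : ℕ) < k then 1 else 0

/-- The set of positive roots `R₊`. -/
def Rpos (n : ℕ) (β : Fin n → ℤ) : Prop := ∃ i j : Fin n, i < j ∧ β = eps n i - eps n j

/-- The Coxeter length: minimal length of a word in the simple transpositions. -/
def len (n : ℕ) (w : Equiv.Perm (Fin n)) : ℕ :=
  sInf {k | ∃ l : List ℕ, (∀ j ∈ l, j + 1 < n) ∧ l.length = k ∧ wordProd n l = w}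

/-- A choice of reduced word for `w`. -/
def redWord (n : ℕ) (w : Equiv.Perm (Fin n)) : List ℕ :=
  if h : ∃ l : List ℕ, (∀ j ∈ l, j + 1 < n) ∧ l.length = len n w ∧ wordProd n l = w
  then h.choose else []

/-! ### Columns -/

lemma col_card_le (n : ℕ) (C : Finset (Fin n)) : C.card ≤ n := by
  simpa using Finset.card_le_univ C

/-- The minimal length coset representative `u_C` attached to a column `C`:
it sends `1, …, ℓ` to the entries of `C` in increasing order and `ℓ+1, …, n` to the
entries of the complement of `C` in increasing order. -/
def colPerm (n : ℕ) (C : Finset (Fin n)) : Equiv.Perm (Fin n) :=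
  ((finCongr ((Nat.add_sub_cancel' (col_card_le n C)).symm)).trans
    finSumFinEquiv.symm).trans <|
  ((Equiv.sumCongr (C.orderIsoOfFin rfl).toEquiv
      ((Cᶜ.orderIsoOfFin (by simp [Finset.card_compl])).toEquiv)).trans <|
    (Equiv.sumCongr (Equiv.refl _) (Equiv.subtypeEquivRight (fun x => Finset.mem_compl))).trans
      (Equiv.sumCompl (fun x => x ∈ C)))

/-- The `k`-th smallest entry of a column (0-indexed, as a natural number; junk `0` if
out of range). -/
def nth (n : ℕ) (C : Finset (Fin n)) (k : ℕ) : ℕ := ((C.sort (· ≤ ·)).map Fin.val).getD k 0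

/-- The action of the simple transposition `s_j` on columns. -/
def sCol (n : ℕ) (j : ℕ) (C : Finset (Fin n)) : Finset (Fin n) := C.image (sgen n j)

/-- Semistandardness of the two-column filling `F ⊗ E` (`F` the left column):
entrywise `f_i ≤ e_i`. -/
def pairSS (n : ℕ) (F E : Finset (Fin n)) : Prop := ∀ k < E.card, nth n F k ≤ nth n E k

/-- A filling by columns (leftmost column first) is semistandard iff all adjacent pairs are. -/
def isSSYT (n : ℕ) (L : List (Finset (Fin n))) : Prop := L.Chain' (pairSS n)

/-- The set `B(ϖ_ℓ)` of columns of length `ℓ`. -/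
def colFinset (n : ℕ) (ℓ : ℕ) : Finset (Finset (Fin n)) := Finset.univ.filter fun C => C.card = ℓ

/-- The highest weight column `(1, …, k)`. -/
def hwCol (n : ℕ) (k : ℕ) : Finset (Fin n) := Finset.univ.filter fun x => (x : ℕ) < k

/-- The vector `⃗C ∈ ℤⁿ` attached to a column `C`. -/
def vecOf (n : ℕ) (C : Finset (Fin n)) : Fin n → ℤ := fun i => if i ∈ C then 1 else 0

/-- The sign `σ^j_C`: `-1` if `j ∈ C` and `j+1 ∉ C`, and `+1` otherwise. -/
def sigmaSign (n : ℕ) (j : ℕ) (C : Finset (Fin n)) : ℤ :=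
  if h : j + 1 < n then
    (if (⟨j, Nat.lt_of_succ_lt h⟩ : Fin n) ∈ C ∧ (⟨j + 1, h⟩ : Fin n) ∉ C then -1 else 1)
  else 1

/-! ### Shapes and tableaux -/

/-- The length `λ'_{j+1}` of the `(j+1)`-st column (0-indexed `j`) of the Young diagram
of a partition `λ`. -/
def shapeColLen (n : ℕ) (μ : Fin n → ℤ) (j : ℕ) : ℕ :=
  (Finset.univ.filter fun i : Fin n => (j : ℤ) < μ i).card

/-- The number of columns of the Young diagram of a dominant weight. -/
def numCols (n : ℕ) (μ : Fin n → ℤ) : ℕ := Finset.univ.sup fun i : Fin n => (μ i).toNat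

/-- The highest weight tableau `T⁰_μ`: row `i` is filled with `i`, i.e. its columns are the
highest weight columns. -/
def hwTableau (n : ℕ) (μ : Fin n → ℤ) : List (Finset (Fin n)) :=
  List.ofFn fun j : Fin (numCols n μ) => hwCol n (shapeColLen n μ (j : ℕ))

/-- The content vector of a tableau: `(wtVec T) i` is the number of entries equal to `i`. -/
def wtVec (n : ℕ) (L : List (Finset (Fin n))) : Fin n → ℤ :=
  fun i => ((L.filter fun C => i ∈ C).length : ℤ)

/-! ### Macdonald's ψ statistic -/

/-- Number of entries `≤ i` in the column at position `p` (0-indexed from the left). -/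
def colCount (n : ℕ) (L : List (Finset (Fin n))) (i p : ℕ) : ℕ :=
  ((L.getD p ∅).filter fun x => (x : ℕ) < i).card

/-- The factor `ψ_{T_{≤ i+1}/T_{≤ i}}` of Macdonald's ψ. -/
def stripFactor (n : ℕ) (L : List (Finset (Fin n))) (i : ℕ) : HR :=
  ∏ p ∈ Finset.range L.length,
    if colCount n L (i + 1) p = colCount n L i p ∧
        colCount n L (i + 1) (p + 1) = colCount n L i (p + 1) + 1 then
      1 - tt ^ (colCount n L i p - colCount n L i (p + 1))
    else 1

/-- Macdonald's `ψ_T = ∏_{i=1}^{n-1} ψ_{T_{≤ i+1}/T_{≤ i}}` for a semistandard tableau. -/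
def macPsi (n : ℕ) (L : List (Finset (Fin n))) : HR := ∏ i ∈ Finset.Ico 1 n, stripFactor n L i

/-- Macdonald's tableau statistic, extended by `0` to non-semistandard fillings. -/
def psiT (n : ℕ) (L : List (Finset (Fin n))) : HR := if isSSYT n L then macPsi n L else 0

/-! ### The affine Hecke algebra -/

/-- Generators of the affine Hecke algebra. -/
inductive AGen (n : ℕ) : Type
  | T : ℕ → AGen n
  | X : Fin n → AGen n
  | Xinv : Fin n → AGen n

/-- The free algebra on the generators. -/
abbrev FA (n : ℕ) := FreeAlgebra HR (AGen n)

def fT (n : ℕ) (j : ℕ) : FA n := FreeAlgebra.ι HR (AGen.T j)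
def fX (n : ℕ) (i : Fin n) : FA n := FreeAlgebra.ι HR (AGen.X i)
def fXi (n : ℕ) (i : Fin n) : FA n := FreeAlgebra.ι HR (AGen.Xinv i)

/-- The defining relations of the type `GL_n` affine Hecke algebra. -/
inductive ARel (n : ℕ) : FA n → FA n → Prop
  | junk (j : ℕ) (h : ¬ j + 1 < n) : ARel n (fT n j) 1
  | quad (j : ℕ) (h : j + 1 < n) :
      ARel n (fT n j * fT n j) ((tt - 1) • fT n j + algebraMap HR (FA n) tt)
  | braid (j : ℕ) (h : j + 2 < n) :
      ARel n (fT n j * fT n (j + 1) * fT n j) (fT n (j + 1) * fT n j * fT n (j + 1))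
  | commT (j k : ℕ) (hjk : j + 1 < k) (hk : k + 1 < n) :
      ARel n (fT n j * fT n k) (fT n k * fT n j)
  | commX (i i' : Fin n) : ARel n (fX n i * fX n i') (fX n i' * fX n i)
  | XinvL (i : Fin n) : ARel n (fX n i * fXi n i) 1
  | XinvR (i : Fin n) : ARel n (fXi n i * fX n i) 1
  | TXT (j : ℕ) (h : j + 1 < n) :
      ARel n (fT n j * fX n ⟨j, Nat.lt_of_succ_lt h⟩ * fT n j) (tt • fX n ⟨j + 1, h⟩)
  | TXcomm (j : ℕ) (h : j + 1 < n) (i : Fin n) (hi1 : (i : ℕ) ≠ j) (hi2 : (i : ℕ) ≠ j + 1) :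
      ARel n (fT n j * fX n i) (fX n i * fT n j)

/-- The type `GL_n` affine Hecke algebra. -/
abbrev H (n : ℕ) := RingQuot (ARel n)

/-- The generator `T_j` of the (affine) Hecke algebra. -/
def Tg (n : ℕ) (j : ℕ) : H n := RingQuot.mkAlgHom HR (ARel n) (fT n j)

/-- The generator `X_i`. -/
def Xg (n : ℕ) (i : Fin n) : H n := RingQuot.mkAlgHom HR (ARel n) (fX n i)

/-- The generator `X_i⁻¹`. -/
def Xig (n : ℕ) (i : Fin n) : H n := RingQuot.mkAlgHom HR (ARel n) (fXi n i)

/-- The scalar `t` inside `H`. -/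
def tH (n : ℕ) : H n := algebraMap HR (H n) tt

/-- The scalar `t^k` inside `H`. -/
def tpow (n : ℕ) (k : ℕ) : H n := algebraMap HR (H n) (tt ^ k)

/-- The monomial `X^μ` for `μ ∈ ℤⁿ`. -/
def Xmon (n : ℕ) (μ : Fin n → ℤ) : H n :=
  (List.ofFn fun i : Fin n =>
    if 0 ≤ μ i then Xg n i ^ (μ i).toNat else Xig n i ^ (-μ i).toNat).prod

/-- The product `T_{i₁} ⋯ T_{i_ℓ}` of a word. -/
def TofWord (n : ℕ) (l : List ℕ) : H n := (l.map (Tg n)).prod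

/-- The element `T_w`, defined via a choice of reduced word for `w`. -/
def Tw (n : ℕ) (w : Equiv.Perm (Fin n)) : H n := TofWord n (redWord n w)

/-- The finite Hecke symmetrizer `1₀ = Σ_{w ∈ S_n} T_w`. -/
def one0 (n : ℕ) : H n := ∑ w : Equiv.Perm (Fin n), Tw n w

/-- The stabilizer `S_{n,λ}` as a finset. -/
def stabFinset (n : ℕ) (lam : Fin n → ℤ) : Finset (Equiv.Perm (Fin n)) :=
  Finset.univ.filter fun w => wAct n w lam = lam

/-- The parabolic symmetrizer `1_λ = Σ_{w ∈ S_{n,λ}} T_w`. -/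
def onePara (n : ℕ) (lam : Fin n → ℤ) : H n := ∑ w ∈ stabFinset n lam, Tw n w

/-- The Poincaré polynomial `W_λ(t) = Σ_{w ∈ S_{n,λ}} t^{ℓ(w)}`. -/
def Wlam (n : ℕ) (lam : Fin n → ℤ) : HR := ∑ w ∈ stabFinset n lam, tt ^ len n w

/-- The parabolic subalgebra `H_{n,λ}`, as the span of `{T_w : w ∈ S_{n,λ}}`. -/
def HparaM (n : ℕ) (lam : Fin n → ℤ) : Submodule HR (H n) :=
  Submodule.span HR (Tw n '' {w | wAct n w lam = lam})

/-- The finite Hecke algebra `H_n`, the subalgebra generated by the `T_j`. -/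
def Hfin (n : ℕ) : Subalgebra HR (H n) := Algebra.adjoin HR (Set.range (Tg n))

/-- The coefficient `h_{C, S}` of the parabolic decomposition
`h = Σ_{F ∈ B(ϖ_ℓ)} T_{u_F} h_F` (defined via choice; it is unique). -/
def paraCoeff (n : ℕ) (ℓ : ℕ) (h : H n) (C : Finset (Fin n)) : H n :=
  if hex : ∃ g : Finset (Fin n) → H n,
      (∀ F : Finset (Fin n), F.card = ℓ → g F ∈ HparaM n (varpi n ℓ)) ∧
      h = ∑ F ∈ colFinset n ℓ, Tw n (colPerm n F) * g F
  then hex.choose C else 0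

/-- The elements `Ψ_T` of the finite Hecke algebra, defined by recursion on the columns of `T`
(leftmost column first).  By convention `Ψ` of the empty tableau is `1₀`. -/
def Psi (n : ℕ) : List (Finset (Fin n)) → H n
  | [] => one0 n
  | [C] => tpow n (len n (colPerm n C)) * Ring.inverse (Tw n (colPerm n C)⁻¹) *
      onePara n (varpi n C.card)
  | C :: S => tpow n (len n (colPerm n C)) * Ring.inverse (Tw n (colPerm n C)⁻¹) *
      paraCoeff n C.card (Psi n S) C

end HLHecke
namespace HLHecke

/-! ### Part 1: inversions -/
def ninv (n : ℕ) (w : Equiv.Perm (Fin n)) : ℕ :=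
  (Finset.univ.filter fun p : Fin n × Fin n => p.1 < p.2 ∧ w⁻¹ p.2 < w⁻¹ p.1).card

lemma sgen_of_lt {n j : ℕ} (h : j + 1 < n) :
    sgen n j = Equiv.swap ⟨j, Nat.lt_of_succ_lt h⟩ ⟨j + 1, h⟩ := by
  simp [sgen, h]

lemma sgen_mul_self (n j : ℕ) : sgen n j * sgen n j = 1 := by
  unfold sgen
  split_ifs <;> simp

lemma sgen_inv (n j : ℕ) : (sgen n j)⁻¹ = sgen n j := by
  unfold sgen
  split_ifs <;> simp

lemma sgen_sgen (n j : ℕ) (x : Fin n) : sgen n j (sgen n j x) = x := by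
  rw [← Equiv.Perm.mul_apply, sgen_mul_self]; rfl

lemma sgen_val {n j : ℕ} (h : j + 1 < n) (x : Fin n) :
    (sgen n j x : ℕ) = if (x : ℕ) = j then j + 1 else if (x : ℕ) = j + 1 then j else x := by
  rw [sgen_of_lt h, Equiv.swap_apply_def]
  split_ifs with h1 h2 h3 h4 h5 <;> simp_all [Fin.ext_iff]

lemma sgen_lt {n j : ℕ} (h : j + 1 < n) (p q : Fin n) (hpq : p < q)
    (hne : ¬ ((p : ℕ) = j ∧ (q : ℕ) = j + 1)) : sgen n j p < sgen n j q := by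
  rw [Fin.lt_def] at *
  rw [sgen_val h, sgen_val h]
  split_ifs <;> omega

/-- ascent -/
def asc (n : ℕ) (j : ℕ) (h : j + 1 < n) (w : Equiv.Perm (Fin n)) : Prop :=
  w⁻¹ ⟨j, Nat.lt_of_succ_lt h⟩ < w⁻¹ ⟨j + 1, h⟩

lemma sgen_left {n j : ℕ} (h : j + 1 < n) :
    sgen n j ⟨j, Nat.lt_of_succ_lt h⟩ = ⟨j + 1, h⟩ := by
  rw [sgen_of_lt h]; simp

lemma sgen_right {n j : ℕ} (h : j + 1 < n) :
    sgen n j ⟨j + 1, h⟩ = ⟨j, Nat.lt_of_succ_lt h⟩ := by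
  rw [sgen_of_lt h]; simp

lemma smul_inv_apply (n j : ℕ) (w : Equiv.Perm (Fin n)) (x : Fin n) :
    (sgen n j * w)⁻¹ x = w⁻¹ (sgen n j x) := by
  rw [mul_inv_rev, sgen_inv]; rfl

lemma asc_smul {n j : ℕ} (h : j + 1 < n) (w : Equiv.Perm (Fin n)) :
    asc n j h (sgen n j * w) ↔ ¬ asc n j h w := by
  unfold asc
  rw [smul_inv_apply, smul_inv_apply, sgen_left, sgen_right, not_lt]
  constructor
  · exact fun h => h.le
  · intro h'
    refine lt_of_le_of_ne h' ?_
    intro he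
    have := w⁻¹.injective he
    simp [Fin.ext_iff] at this

lemma ninv_smul {n j : ℕ} (h : j + 1 < n) (w : Equiv.Perm (Fin n)) (ha : asc n j h w) :
    ninv n (sgen n j * w) = ninv n w + 1 := by
  unfold ninv
  have : (Finset.univ.filter fun p : Fin n × Fin n =>
      p.1 < p.2 ∧ (sgen n j * w)⁻¹ p.2 < (sgen n j * w)⁻¹ p.1) =
      insert (⟨j, Nat.lt_of_succ_lt h⟩, ⟨j + 1, h⟩)
      ((Finset.univ.filter fun p : Fin n × Fin n => p.1 < p.2 ∧ w⁻¹ p.2 < w⁻¹ p.1).map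
        ((sgen n j).prodCongr (sgen n j)).toEmbedding) := by
    ext ⟨p, q⟩
    simp only [Finset.mem_filter, Finset.mem_univ, true_and, Finset.mem_insert, Finset.mem_map,
      smul_inv_apply, Prod.mk.injEq, Prod.exists, Equiv.coe_toEmbedding, Equiv.prodCongr_apply,
      Prod.map_apply]
    constructor
    · rintro ⟨h1, h2⟩
      by_cases hc : (p : ℕ) = j ∧ (q : ℕ) = j + 1
      · left; simp [Fin.ext_iff, hc]
      · right
        exact ⟨sgen n j p, sgen n j q, ⟨sgen_lt h p q h1 hc, h2⟩, sgen_sgen _ _ _, sgen_sgen _ _ _⟩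
    · rintro (⟨rfl, rfl⟩ | ⟨p', q', ⟨h1, h2⟩, rfl, rfl⟩)
      · refine ⟨by simp [Fin.lt_def], ?_⟩
        rw [sgen_left, sgen_right]; exact ha
      · rw [sgen_sgen, sgen_sgen]
        refine ⟨sgen_lt h p' q' h1 ?_, h2⟩
        rintro ⟨e1, e2⟩
        have e1' : p' = ⟨j, Nat.lt_of_succ_lt h⟩ := Fin.ext e1
        have e2' : q' = ⟨j + 1, h⟩ := Fin.ext e2
        subst e1' e2'
        exact absurd ha (not_lt.2 h2.le)
  rw [this, Finset.card_insert_of_notMem, Finset.card_map]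
  simp only [Finset.mem_map, Finset.mem_filter, Finset.mem_univ, true_and, Prod.exists,
    Equiv.coe_toEmbedding, Equiv.prodCongr_apply, Prod.map_apply, Prod.mk.injEq, not_exists, not_and]
  rintro p q ⟨h1, h2⟩ e1 e2
  have e1' := congrArg (sgen n j) e1
  have e2' := congrArg (sgen n j) e2
  rw [sgen_sgen, sgen_left h] at e1'
  rw [sgen_sgen, sgen_right h] at e2'
  subst e1' e2'
  simp [Fin.lt_def] at h1

lemma ninv_smul' {n j : ℕ} (h : j + 1 < n) (w : Equiv.Perm (Fin n)) (ha : ¬ asc n j h w) :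
    ninv n w = ninv n (sgen n j * w) + 1 := by
  have := ninv_smul h (sgen n j * w) ((asc_smul h w).2 ha)
  rwa [← mul_assoc, sgen_mul_self, one_mul] at this

lemma ninv_one (n : ℕ) : ninv n 1 = 0 := by
  unfold ninv
  rw [Finset.card_eq_zero, Finset.filter_eq_empty_iff]
  rintro ⟨p, q⟩ _ ⟨h1, h2⟩
  simp at h1 h2
  exact absurd h1 (not_lt.2 h2.le)

lemma ninv_wordProd (n : ℕ) (l : List ℕ) (hl : ∀ j ∈ l, j + 1 < n) :
    ninv n (wordProd n l) ≤ l.length := by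
  induction l with
  | nil => simp [wordProd, ninv_one]
  | cons j l ih =>
    have ih := ih (fun k hk => hl k (List.mem_cons_of_mem _ hk))
    have h := hl j List.mem_cons_self
    have e : wordProd n (j :: l) = sgen n j * wordProd n l := by simp [wordProd]
    rw [e, List.length_cons]
    by_cases ha : asc n j h (wordProd n l)
    · rw [ninv_smul h _ ha]; omega
    · have := ninv_smul' h _ ha; omega

lemma eq_one_of_asc (n : ℕ) (w : Equiv.Perm (Fin n)) (hw : ∀ j h, asc n j h w) : w = 1 := by
  have hm : StrictMono (w⁻¹ : Equiv.Perm (Fin n)) := by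
    cases n with
    | zero => intro x; exact x.elim0
    | succ m =>
      rw [Fin.strictMono_iff_lt_succ]
      intro i
      have := hw i (by omega)
      exact this
  have h2 : (w⁻¹ : Equiv.Perm (Fin n)) = 1 := by
    have := Subsingleton.elim (StrictMono.orderIsoOfSurjective _ hm (w⁻¹).surjective)
      (OrderIso.refl (Fin n))
    ext x
    have h3 := congrArg (fun f : Fin n ≃o Fin n => ((f x : Fin n) : ℕ)) this
    simpa using h3
  simpa using h2

lemma exists_word (n : ℕ) (k : ℕ) : ∀ w : Equiv.Perm (Fin n), ninv n w = k →
    ∃ l : List ℕ, (∀ j ∈ l, j + 1 < n) ∧ l.length = k ∧ wordProd n l = w := by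
  induction k with
  | zero =>
    intro w hw
    refine ⟨[], by simp, rfl, ?_⟩
    rw [eq_one_of_asc n w]
    · simp [wordProd]
    · intro j h
      by_contra ha
      have := ninv_smul' h w ha
      omega
  | succ k ih =>
    intro w hw
    have : ∃ j h, ¬ asc n j h w := by
      by_contra hc
      push Not at hc
      rw [eq_one_of_asc n w hc, ninv_one] at hw
      omega
    obtain ⟨j, h, ha⟩ := this
    have := ninv_smul' h w ha
    obtain ⟨l, h1, h2, h3⟩ := ih (sgen n j * w) (by omega)
    refine ⟨j :: l, ?_, by simp [h2], ?_⟩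
    · intro i hi
      rcases List.mem_cons.1 hi with rfl | hi
      · exact h
      · exact h1 i hi
    · have e : wordProd n (j :: l) = sgen n j * wordProd n l := by simp [wordProd]
      rw [e, h3, ← mul_assoc, sgen_mul_self, one_mul]

lemma len_eq_ninv (n : ℕ) (w : Equiv.Perm (Fin n)) : len n w = ninv n w := by
  unfold len
  obtain h := exists_word n _ w rfl
  apply le_antisymm
  · exact Nat.sInf_le h
  · have hne : {k | ∃ l : List ℕ, (∀ j ∈ l, j + 1 < n) ∧ l.length = k ∧
        wordProd n l = w}.Nonempty := ⟨_, h⟩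
    obtain ⟨l, h1, h2, h3⟩ := Nat.sInf_mem hne
    rw [← h2, ← h3]
    exact ninv_wordProd n l h1

/-- reduced word -/
def Red (n : ℕ) (l : List ℕ) : Prop := (∀ j ∈ l, j + 1 < n) ∧ l.length = ninv n (wordProd n l)

lemma redWord_prod (n : ℕ) (w : Equiv.Perm (Fin n)) : wordProd n (redWord n w) = w := by
  have h : ∃ l : List ℕ, (∀ j ∈ l, j + 1 < n) ∧ l.length = len n w ∧ wordProd n l = w := by
    rw [len_eq_ninv]; exact exists_word n _ w rfl
  unfold redWord
  rw [dif_pos h]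
  exact h.choose_spec.2.2

lemma redWord_red (n : ℕ) (w : Equiv.Perm (Fin n)) : Red n (redWord n w) := by
  have h : ∃ l : List ℕ, (∀ j ∈ l, j + 1 < n) ∧ l.length = len n w ∧ wordProd n l = w := by
    rw [len_eq_ninv]; exact exists_word n _ w rfl
  refine ⟨?_, ?_⟩
  · unfold redWord
    rw [dif_pos h]
    exact h.choose_spec.1
  · rw [redWord_prod, ← len_eq_ninv]
    unfold redWord
    rw [dif_pos h]
    exact h.choose_spec.2.1

lemma wordProd_cons (n j : ℕ) (l : List ℕ) : wordProd n (j :: l) = sgen n j * wordProd n l := by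
  simp [wordProd]

lemma Red.cons {n j : ℕ} {l : List ℕ} (hr : Red n (j :: l)) :
    Red n l ∧ ∃ h : j + 1 < n, asc n j h (wordProd n l) := by
  have h := hr.1 j List.mem_cons_self
  have h1 : ∀ j ∈ l, j + 1 < n := fun k hk => hr.1 k (List.mem_cons_of_mem _ hk)
  have h2 := hr.2
  rw [wordProd_cons, List.length_cons] at h2
  have h3 := ninv_wordProd n l h1
  by_cases ha : asc n j h (wordProd n l)
  · rw [ninv_smul h _ ha] at h2
    exact ⟨⟨h1, by omega⟩, h, ha⟩
  · have := ninv_smul' h _ ha; omega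

lemma wordProd_reverse (n : ℕ) (l : List ℕ) : wordProd n l.reverse = (wordProd n l)⁻¹ := by
  induction l with
  | nil => simp [wordProd]
  | cons j l ih =>
    rw [wordProd_cons, mul_inv_rev, ← ih, sgen_inv]
    simp [wordProd]

lemma ninv_inv_le (n : ℕ) (w : Equiv.Perm (Fin n)) : ninv n w⁻¹ ≤ ninv n w := by
  obtain ⟨l, h1, h2, h3⟩ := exists_word n _ w rfl
  have := ninv_wordProd n l.reverse (by simpa using h1)
  rw [wordProd_reverse, h3] at this
  simpa [h2] using this

lemma ninv_inv (n : ℕ) (w : Equiv.Perm (Fin n)) : ninv n w⁻¹ = ninv n w := by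
  apply le_antisymm (ninv_inv_le n w)
  simpa using ninv_inv_le n w⁻¹

lemma Red.reverse {n : ℕ} {l : List ℕ} (hr : Red n l) : Red n l.reverse := by
  refine ⟨by simpa using hr.1, ?_⟩
  rw [wordProd_reverse, ninv_inv, ← hr.2, List.length_reverse]

end HLHecke
namespace HLHecke

/-! ### Part 2: the regular representation -/
abbrev MM (n : ℕ) : Type := Equiv.Perm (Fin n) →₀ HR

/-- basis vector -/
def ee {n : ℕ} (w : Equiv.Perm (Fin n)) : MM n := Finsupp.single w 1

def Lab {n : ℕ} (a b : Fin n) : MM n →ₗ[HR] MM n :=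
  Finsupp.linearCombination HR (fun w : Equiv.Perm (Fin n) =>
    if w⁻¹ a < w⁻¹ b then ee (Equiv.swap a b * w)
    else (tt - 1) • ee w + tt • ee (Equiv.swap a b * w))

lemma Lab_ee {n : ℕ} (a b : Fin n) (w : Equiv.Perm (Fin n)) :
    Lab a b (ee w) = if w⁻¹ a < w⁻¹ b then ee (Equiv.swap a b * w)
    else (tt - 1) • ee w + tt • ee (Equiv.swap a b * w) := by
  unfold Lab
  conv_lhs => unfold ee
  rw [Finsupp.linearCombination_single, one_smul]
  rfl

lemma MM_ext {n : ℕ} {f g : MM n →ₗ[HR] MM n} (h : ∀ w, f (ee w) = g (ee w)) : f = g := by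
  apply Finsupp.lhom_ext'
  intro w
  apply LinearMap.ext_ring
  exact h w

lemma swap_mul_inv_apply {n : ℕ} (a b : Fin n) (w : Equiv.Perm (Fin n)) (x : Fin n) :
    (Equiv.swap a b * w)⁻¹ x = w⁻¹ (Equiv.swap a b x) := by
  rw [mul_inv_rev, Equiv.swap_inv]; rfl

lemma Lab_lt {n : ℕ} {a b : Fin n} {w : Equiv.Perm (Fin n)} (h : w⁻¹ a < w⁻¹ b) :
    Lab a b (ee w) = ee (Equiv.swap a b * w) := by
  rw [Lab_ee, if_pos h]

lemma Lab_gt {n : ℕ} {a b : Fin n} {w : Equiv.Perm (Fin n)} (h : w⁻¹ b < w⁻¹ a) :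
    Lab a b (ee w) = (tt - 1) • ee w + tt • ee (Equiv.swap a b * w) := by
  rw [Lab_ee, if_neg (not_lt.2 h.le)]

lemma inv_lt_or {n : ℕ} {a b : Fin n} (hab : a ≠ b) (w : Equiv.Perm (Fin n)) :
    w⁻¹ a < w⁻¹ b ∨ w⁻¹ b < w⁻¹ a :=
  lt_or_gt_of_ne (fun h => hab (w⁻¹.injective h))

lemma Lab_quad {n : ℕ} {a b : Fin n} (hab : a ≠ b) :
    Lab a b * Lab a b = (tt - 1) • Lab a b + algebraMap HR (Module.End HR (MM n)) tt := by
  apply MM_ext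
  intro w
  simp only [Module.End.mul_apply, LinearMap.add_apply, LinearMap.smul_apply,
    Module.algebraMap_end_apply]
  have hss : Equiv.swap a b * (Equiv.swap a b * w) = w := by simp [← mul_assoc]
  rcases inv_lt_or hab w with h | h
  · rw [Lab_lt h, Lab_gt (by simpa [swap_mul_inv_apply] using h), hss]
  · have : (Equiv.swap a b * w)⁻¹ a < (Equiv.swap a b * w)⁻¹ b := by
      simpa [swap_mul_inv_apply] using h
    rw [Lab_gt h, map_add, map_smul, map_smul, Lab_gt h, Lab_lt this, hss]

lemma Lab_comm {n : ℕ} {a b c d : Fin n} (hab : a ≠ b) (hcd : c ≠ d) (hac : a ≠ c) (had : a ≠ d)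
    (hbc : b ≠ c) (hbd : b ≠ d) :
    Lab a b * Lab c d = Lab c d * Lab a b := by
  apply MM_ext
  intro w
  simp only [Module.End.mul_apply]
  have hss : Equiv.swap a b * (Equiv.swap c d * w) = Equiv.swap c d * (Equiv.swap a b * w) := by
    rw [← mul_assoc, ← mul_assoc]
    congr 1
    apply Equiv.Perm.Disjoint.commute
    rw [Equiv.Perm.disjoint_iff_disjoint_support, Equiv.Perm.support_swap hab,
      Equiv.Perm.support_swap hcd]
    simp [hac, had, hbc, hbd, hac.symm, had.symm, hbc.symm, hbd.symm]
  have e1 : (Equiv.swap a b * w)⁻¹ c = w⁻¹ c := by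
    rw [swap_mul_inv_apply, Equiv.swap_apply_of_ne_of_ne hac.symm hbc.symm]
  have e2 : (Equiv.swap a b * w)⁻¹ d = w⁻¹ d := by
    rw [swap_mul_inv_apply, Equiv.swap_apply_of_ne_of_ne had.symm hbd.symm]
  have e3 : (Equiv.swap c d * w)⁻¹ a = w⁻¹ a := by
    rw [swap_mul_inv_apply, Equiv.swap_apply_of_ne_of_ne hac had]
  have e4 : (Equiv.swap c d * w)⁻¹ b = w⁻¹ b := by
    rw [swap_mul_inv_apply, Equiv.swap_apply_of_ne_of_ne hbc hbd]
  rw [Lab_ee, Lab_ee a b w]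
  split_ifs with h1 h2 h2 <;>
  simp only [map_add, map_smul, Lab_ee, e1, e2, e3, e4, h1, h2, if_true, if_false, hss]
  module

lemma Lab_braid {n : ℕ} {a b c : Fin n} (hab : a ≠ b) (hac : a ≠ c) (hbc : b ≠ c) :
    Lab a b * Lab b c * Lab a b = Lab b c * Lab a b * Lab b c := by
  apply MM_ext
  intro w
  simp only [Module.End.mul_apply]
  have hss : Equiv.swap a b * (Equiv.swap b c * (Equiv.swap a b * w)) =
      Equiv.swap b c * (Equiv.swap a b * (Equiv.swap b c * w)) := by
    simp only [← mul_assoc]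
    congr 1
    ext x
    simp only [Equiv.Perm.mul_apply, Equiv.swap_apply_def]
    split_ifs <;> simp_all
  have s1 : ∀ w : Equiv.Perm (Fin n), Equiv.swap a b * (Equiv.swap a b * w) = w := by
    intro w; simp [← mul_assoc]
  have s2 : ∀ w : Equiv.Perm (Fin n), Equiv.swap b c * (Equiv.swap b c * w) = w := by
    intro w; simp [← mul_assoc]
  have i1 : ∀ w : Equiv.Perm (Fin n), (Equiv.swap a b * w)⁻¹ a = w⁻¹ b := by
    intro w; simp [swap_mul_inv_apply]
  have i2 : ∀ w : Equiv.Perm (Fin n), (Equiv.swap a b * w)⁻¹ b = w⁻¹ a := by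
    intro w; simp [swap_mul_inv_apply]
  have i3 : ∀ w : Equiv.Perm (Fin n), (Equiv.swap a b * w)⁻¹ c = w⁻¹ c := by
    intro w; rw [swap_mul_inv_apply, Equiv.swap_apply_of_ne_of_ne hac.symm hbc.symm]
  have i4 : ∀ w : Equiv.Perm (Fin n), (Equiv.swap b c * w)⁻¹ a = w⁻¹ a := by
    intro w; rw [swap_mul_inv_apply, Equiv.swap_apply_of_ne_of_ne hab hac]
  have i5 : ∀ w : Equiv.Perm (Fin n), (Equiv.swap b c * w)⁻¹ b = w⁻¹ c := by
    intro w; simp [swap_mul_inv_apply]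
  have i6 : ∀ w : Equiv.Perm (Fin n), (Equiv.swap b c * w)⁻¹ c = w⁻¹ b := by
    intro w; simp [swap_mul_inv_apply]
  rcases inv_lt_or hab w with h1 | h1 <;> rcases inv_lt_or hbc w with h2 | h2 <;>
  rcases inv_lt_or hac w with h3 | h3 <;>
  first
  | (exfalso; omega)
  | (simp only [map_add, map_smul, Lab_ee, i1, i2, i3, i4, i5, i6, h1, h2, h3, not_lt.2 h1.le,
      not_lt.2 h2.le, not_lt.2 h3.le, if_true, if_false, s1, s2, hss, smul_add]
     try module)

end HLHecke
namespace HLHecke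

/-! ### Part 3: Jucys-Murphy elements and the representation of the affine Hecke algebra -/
def JM {G : Type*} [Group G] (c : G) (U : ℕ → G) : ℕ → G
  | 0 => 1
  | j + 1 => c * (U j * JM c U j * U j)

lemma JM_comm_lt {G : Type*} [Group G] (n : ℕ) (c : G) (hc : ∀ g, Commute c g) (U : ℕ → G)
    (hU : ∀ j k, j + 1 < k → k + 1 < n → Commute (U j) (U k))
    (j : ℕ) (hj : j + 1 < n) : ∀ i, i < j → Commute (U j) (JM c U i) := by
  intro i
  induction i with
  | zero => intro _; exact Commute.one_right _
  | succ i ih =>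
    intro hi
    have h1 := (hU i j hi hj).symm
    exact (hc _).symm.mul_right ((h1.mul_right (ih (by omega))).mul_right h1)

lemma JM_comm_gt {G : Type*} [Group G] (n : ℕ) (c : G) (hc : ∀ g, Commute c g) (U : ℕ → G)
    (hU : ∀ j k, j + 1 < k → k + 1 < n → Commute (U j) (U k))
    (hB : ∀ j, j + 2 < n → U j * U (j + 1) * U j = U (j + 1) * U j * U (j + 1))
    (j : ℕ) : ∀ d, j + 2 + d < n → Commute (U j) (JM c U (j + 2 + d)) := by
  intro d
  induction d with
  | zero =>
    intro h
    have h1 : Commute (U (j + 1)) (JM c U j) :=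
      JM_comm_lt n c hc U hU (j + 1) (by omega) j (by omega)
    have hb := hB j (by omega)
    change Commute (U j) (c * (U (j + 1) * (c * (U j * JM c U j * U j)) * U (j + 1)))
    refine (hc _).symm.mul_right ?_
    have e : U (j + 1) * (c * (U j * JM c U j * U j)) * U (j + 1) =
      c * (U (j + 1) * U j * JM c U j * (U j * U (j + 1))) := by
      rw [← mul_assoc (U (j + 1)) c, ← (hc (U (j + 1))).eq]
      group
    rw [e]
    refine (hc _).symm.mul_right ?_
    show U j * _ = _ * U j
    calc U j * (U (j + 1) * U j * JM c U j * (U j * U (j + 1)))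
        = (U j * U (j + 1) * U j) * JM c U j * (U j * U (j + 1)) := by group
      _ = U (j + 1) * U j * (U (j + 1) * JM c U j) * (U j * U (j + 1)) := by rw [hb]; group
      _ = U (j + 1) * U j * JM c U j * (U (j + 1) * U j * U (j + 1)) := by rw [h1.eq]; group
      _ = U (j + 1) * U j * JM c U j * (U j * U (j + 1)) * U j := by rw [← hb]; group
  | succ d ih =>
    intro h
    have h1 := hU j (j + 2 + d) (by omega) (by omega)
    exact (hc _).symm.mul_right ((h1.mul_right (ih (by omega))).mul_right h1)

lemma JM_comm {G : Type*} [Group G] (n : ℕ) (c : G) (hc : ∀ g, Commute c g) (U : ℕ → G)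
    (hU : ∀ j k, j + 1 < k → k + 1 < n → Commute (U j) (U k))
    (hB : ∀ j, j + 2 < n → U j * U (j + 1) * U j = U (j + 1) * U j * U (j + 1))
    (k : ℕ) (hk : k < n) : ∀ i, i < k → Commute (JM c U i) (JM c U k) := by
  intro i
  induction i with
  | zero => intro _; exact Commute.one_left _
  | succ i ih =>
    intro hi
    obtain ⟨d, rfl⟩ : ∃ d, k = i + 2 + d := ⟨k - (i + 2), by omega⟩
    have h1 := JM_comm_gt n c hc U hU hB i d hk
    exact (hc _).mul_left ((h1.mul_left (ih (by omega))).mul_left h1)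

/-- the inverse of `t` -/
def tinv : HR := LaurentPolynomial.T (-1)

lemma tt_tinv : tt * tinv = 1 := by
  unfold tt tinv
  rw [← LaurentPolynomial.T_add]; simp

lemma tinv_tt : tinv * tt = 1 := by rw [mul_comm, tt_tinv]

/-- unit from the quadratic relation -/
def qunit {A : Type*} [Ring A] [Algebra HR A] (x : A)
    (hx : x * x = (tt - 1) • x + algebraMap HR A tt) : Aˣ where
  val := x
  inv := tinv • (x + (1 - tt) • 1)
  val_inv := by
    rw [mul_smul_comm, mul_add, hx, mul_smul_comm, mul_one, Algebra.algebraMap_eq_smul_one]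
    have : (tt - 1) • x + tt • (1 : A) + (1 - tt) • x = tt • 1 := by module
    rw [this, smul_smul, tinv_tt, one_smul]
  inv_val := by
    rw [smul_mul_assoc, add_mul, hx, smul_mul_assoc, one_mul, Algebra.algebraMap_eq_smul_one]
    have : (tt - 1) • x + tt • (1 : A) + (1 - tt) • x = tt • 1 := by module
    rw [this, smul_smul, tinv_tt, one_smul]

def LU (n : ℕ) (j : ℕ) : (Module.End HR (MM n))ˣ :=
  if h : j + 1 < n then
    qunit (Lab ⟨j, Nat.lt_of_succ_lt h⟩ ⟨j + 1, h⟩) (Lab_quad (by simp [Fin.ext_iff]))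
  else 1

lemma LU_val {n j : ℕ} (h : j + 1 < n) : (LU n j : Module.End HR (MM n)) =
    Lab ⟨j, Nat.lt_of_succ_lt h⟩ ⟨j + 1, h⟩ := by
  unfold LU; rw [dif_pos h]; rfl

lemma LU_comm (n j k : ℕ) (hjk : j + 1 < k) (hk : k + 1 < n) : Commute (LU n j) (LU n k) := by
  apply Units.ext
  rw [Units.val_mul, Units.val_mul, LU_val (show j + 1 < n by omega), LU_val hk]
  apply Lab_comm <;> simp [Fin.ext_iff] <;> omega

lemma LU_braid (n j : ℕ) (h : j + 2 < n) :
    LU n j * LU n (j + 1) * LU n j = LU n (j + 1) * LU n j * LU n (j + 1) := by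
  apply Units.ext
  simp only [Units.val_mul]
  rw [LU_val (show j + 1 < n by omega), LU_val (show j + 1 + 1 < n by omega)]
  apply Lab_braid <;> simp only [ne_eq, Fin.ext_iff] <;> omega

def tiE (n : ℕ) : (Module.End HR (MM n))ˣ where
  val := algebraMap HR (Module.End HR (MM n)) tinv
  inv := algebraMap HR (Module.End HR (MM n)) tt
  val_inv := by rw [← map_mul, tinv_tt, map_one]
  inv_val := by rw [← map_mul, tt_tinv, map_one]

lemma tiE_comm (n : ℕ) (g : (Module.End HR (MM n))ˣ) : Commute (tiE n) g := by
  apply Units.ext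
  rw [Units.val_mul, Units.val_mul]
  exact Algebra.commutes (A := Module.End HR (MM n)) tinv g.val

def JU (n : ℕ) (i : ℕ) : (Module.End HR (MM n))ˣ := JM (tiE n) (LU n) i

def genMap (n : ℕ) : AGen n → Module.End HR (MM n)
  | AGen.T j => LU n j
  | AGen.X i => JU n i
  | AGen.Xinv i => ((JU n i)⁻¹ : (Module.End HR (MM n))ˣ)

lemma JU_comm (n : ℕ) (i k : Fin n) : Commute (JU n i) (JU n k) := by
  rcases lt_trichotomy (i : ℕ) (k : ℕ) with h | h | h
  · exact JM_comm n (tiE n) (tiE_comm n) (LU n) (LU_comm n) (LU_braid n) k k.2 i h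
  · rw [h]
  · exact (JM_comm n (tiE n) (tiE_comm n) (LU n) (LU_comm n) (LU_braid n) i i.2 k h).symm

lemma LU_JU_comm (n j : ℕ) (h : j + 1 < n) (i : Fin n) (h1 : (i : ℕ) ≠ j) (h2 : (i : ℕ) ≠ j + 1) :
    Commute (LU n j) (JU n i) := by
  rcases lt_or_gt_of_ne h1 with h' | h'
  · exact JM_comm_lt n (tiE n) (tiE_comm n) (LU n) (LU_comm n) j h i h'
  · obtain ⟨d, hd⟩ : ∃ d, (i : ℕ) = j + 2 + d := ⟨i - (j + 2), by omega⟩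
    have := i.2
    rw [hd] at this ⊢
    exact JM_comm_gt n (tiE n) (tiE_comm n) (LU n) (LU_comm n) (LU_braid n) j d this

lemma genMap_rel (n : ℕ) : ∀ ⦃x y : FA n⦄, ARel n x y →
    FreeAlgebra.lift HR (genMap n) x = FreeAlgebra.lift HR (genMap n) y := by
  have hT : ∀ j, FreeAlgebra.lift HR (genMap n) (fT n j) = (LU n j : Module.End HR (MM n)) := by
    intro j; unfold fT; rw [FreeAlgebra.lift_ι_apply]; rfl
  have hX : ∀ i, FreeAlgebra.lift HR (genMap n) (fX n i) = (JU n i : Module.End HR (MM n)) := by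
    intro j; unfold fX; rw [FreeAlgebra.lift_ι_apply]; rfl
  have hXi : ∀ i, FreeAlgebra.lift HR (genMap n) (fXi n i) =
      (((JU n i)⁻¹ : (Module.End HR (MM n))ˣ) : Module.End HR (MM n)) := by
    intro j; unfold fXi; rw [FreeAlgebra.lift_ι_apply]; rfl
  intro x y hxy
  induction hxy with
  | junk j h => rw [hT, map_one]; unfold LU; rw [dif_neg h]; rfl
  | quad j h =>
    rw [map_mul, map_add, map_smul, hT, AlgHom.commutes, LU_val h]
    exact Lab_quad (by simp [Fin.ext_iff])
  | braid j h =>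
    simp only [map_mul, hT]
    exact congrArg Units.val (LU_braid n j h)
  | commT j k hjk hk =>
    simp only [map_mul, hT]
    exact congrArg Units.val (LU_comm n j k hjk hk)
  | commX i i' =>
    simp only [map_mul, hX]
    exact congrArg Units.val (JU_comm n i i')
  | XinvL i => rw [map_mul, hX, hXi, map_one, Units.mul_inv]
  | XinvR i => rw [map_mul, hX, hXi, map_one, Units.inv_mul]
  | TXT j h =>
    rw [map_mul, map_mul, map_smul, hT, hX, hX]
    have e : ((JU n (j + 1) : (Module.End HR (MM n))ˣ) : Module.End HR (MM n)) =
      algebraMap HR _ tinv * (LU n j * JU n j * LU n j) := rfl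
    change _ = tt • ((JU n (j + 1) : (Module.End HR (MM n))ˣ) : Module.End HR (MM n))
    rw [e, ← Algebra.smul_def, smul_smul, tt_tinv, one_smul]
  | TXcomm j h i h1 h2 =>
    simp only [map_mul, hT, hX]
    exact congrArg Units.val (LU_JU_comm n j h i h1 h2)

/-- the representation -/
def rep (n : ℕ) : H n →ₐ[HR] Module.End HR (MM n) :=
  RingQuot.liftAlgHom HR ⟨FreeAlgebra.lift HR (genMap n), genMap_rel n⟩

lemma rep_Tg {n j : ℕ} (h : j + 1 < n) : rep n (Tg n j) =
    Lab ⟨j, Nat.lt_of_succ_lt h⟩ ⟨j + 1, h⟩ := by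
  unfold rep Tg
  rw [RingQuot.liftAlgHom_mkAlgHom_apply]
  unfold fT
  rw [FreeAlgebra.lift_ι_apply]
  exact LU_val h

lemma Tg_quad {n j : ℕ} (h : j + 1 < n) :
    Tg n j * Tg n j = (tt - 1) • Tg n j + algebraMap HR (H n) tt := by
  have := RingQuot.mkAlgHom_rel HR (ARel.quad (n := n) j h)
  rwa [map_mul, map_add, map_smul, AlgHom.commutes] at this

def TU (n j : ℕ) : (H n)ˣ := if h : j + 1 < n then qunit (Tg n j) (Tg_quad h) else 1

lemma TU_val {n j : ℕ} (h : j + 1 < n) : (TU n j : H n) = Tg n j := by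
  unfold TU; rw [dif_pos h]; rfl

lemma TU_inv {n j : ℕ} (h : j + 1 < n) :
    (((TU n j)⁻¹ : (H n)ˣ) : H n) = tinv • (Tg n j + (1 - tt) • 1) := by
  unfold TU; rw [dif_pos h]; rfl

lemma TofWord_unit (n : ℕ) (l : List ℕ) (hl : ∀ j ∈ l, j + 1 < n) :
    TofWord n l = (((l.map (TU n)).prod : (H n)ˣ) : H n) := by
  induction l with
  | nil => simp [TofWord]
  | cons j l ih =>
    have := ih (fun k hk => hl k (List.mem_cons_of_mem _ hk))
    have h := hl j List.mem_cons_self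
    rw [List.map_cons, List.prod_cons, Units.val_mul, ← this, TU_val h]
    simp [TofWord]

lemma inverse_TofWord (n : ℕ) (l : List ℕ) (hl : ∀ j ∈ l, j + 1 < n) :
    Ring.inverse (TofWord n l) =
      (((l.reverse.map (fun j => (TU n j)⁻¹)).prod : (H n)ˣ) : H n) := by
  rw [TofWord_unit n l hl, Ring.inverse_unit, List.prod_inv_reverse, List.map_reverse, List.map_map]
  rfl

end HLHecke
namespace HLHecke

/-! ### Part 4: supports -/

/-- number of values `< m` among the first `a` positions of `x` -/
def cnt {n : ℕ} (a : ℕ) (x : Equiv.Perm (Fin n)) (m : ℕ) : ℕ :=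
  (Finset.univ.filter fun i : Fin n => (i : ℕ) < a ∧ (x i : ℕ) < m).card

lemma Tw_one_aux (n : ℕ) (l : List ℕ) (hr : Red n l) :
    rep n (TofWord n l) (ee 1) = ee (wordProd n l) := by
  induction l with
  | nil => simp [TofWord, wordProd]
  | cons j l ih =>
    obtain ⟨h1, h, ha⟩ := hr.cons
    have e : TofWord n (j :: l) = Tg n j * TofWord n l := by simp [TofWord]
    rw [e, map_mul, Module.End.mul_apply, ih h1, rep_Tg h, Lab_lt ha, wordProd_cons, sgen_of_lt h]

lemma Tw_ee_one (n : ℕ) (w : Equiv.Perm (Fin n)) : rep n (Tw n w) (ee 1) = ee w := by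
  unfold Tw
  rw [Tw_one_aux n _ (redWord_red n w), redWord_prod]

/-- span of basis vectors with index in `S` -/
abbrev spn {n : ℕ} (S : Set (Equiv.Perm (Fin n))) : Submodule HR (MM n) := Finsupp.supported HR HR S

lemma ee_mem {n : ℕ} {S : Set (Equiv.Perm (Fin n))} {w : Equiv.Perm (Fin n)} (h : w ∈ S) :
    ee w ∈ spn S := Finsupp.single_mem_supported HR _ h

lemma spn_map {n : ℕ} {S S' : Set (Equiv.Perm (Fin n))} (f : MM n →ₗ[HR] MM n)
    (h : ∀ w ∈ S, f (ee w) ∈ spn S') : ∀ m ∈ spn S, f m ∈ spn S' := by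
  intro m hm
  rw [spn, Finsupp.supported_eq_span_single] at hm
  induction hm using Submodule.span_induction with
  | mem x hx => obtain ⟨w, hw, rfl⟩ := hx; exact h w hw
  | zero => rw [map_zero]; exact zero_mem _
  | add x y _ _ hx hy => rw [map_add]; exact add_mem hx hy
  | smul c x _ hx => rw [map_smul]; exact Submodule.smul_mem _ _ hx

/-- image of first `b` positions determined: same indicator -/
def sameCol {n : ℕ} (b : ℕ) (u x : Equiv.Perm (Fin n)) : Prop :=
  ∀ y : Fin n, (x⁻¹ y : ℕ) < b ↔ (u⁻¹ y : ℕ) < b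

lemma T_same (n b : ℕ) (l : List ℕ) (hr : Red n l) :
    ∀ m ∈ spn {x : Equiv.Perm (Fin n) | sameCol b 1 x},
      rep n (TofWord n l) m ∈ spn {x | sameCol b (wordProd n l) x} := by
  induction l with
  | nil => intro m hm; simpa [TofWord, wordProd] using hm
  | cons j l ih =>
    intro m hm
    obtain ⟨h1, h, ha⟩ := hr.cons
    have e : TofWord n (j :: l) = Tg n j * TofWord n l := by simp [TofWord]
    rw [e, map_mul, Module.End.mul_apply]
    refine spn_map _ ?_ _ (ih h1 m hm)
    intro x hx
    rw [rep_Tg h]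
    have hs : sameCol b (wordProd n (j :: l)) (sgen n j * x) := by
      intro y
      rw [wordProd_cons, smul_inv_apply, smul_inv_apply]
      exact hx _
    rw [Lab_ee, ← sgen_of_lt h]
    split_ifs with hlt
    · exact ee_mem hs
    · refine add_mem (Submodule.smul_mem _ _ (ee_mem ?_)) (Submodule.smul_mem _ _ (ee_mem hs))
      intro y
      rw [wordProd_cons, smul_inv_apply, ← hx (sgen n j y)]
      have hx1 := hx ⟨j, Nat.lt_of_succ_lt h⟩
      have hx2 := hx ⟨j + 1, h⟩
      unfold asc at ha
      rw [Fin.lt_def] at ha hlt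
      by_cases hy1 : y = ⟨j, Nat.lt_of_succ_lt h⟩
      · rw [hy1, sgen_left h]; omega
      · by_cases hy2 : y = ⟨j + 1, h⟩
        · rw [hy2, sgen_right h]; omega
        · rw [sgen_of_lt h, Equiv.swap_apply_of_ne_of_ne hy1 hy2]

lemma cnt_succ {n : ℕ} (a : ℕ) (x : Equiv.Perm (Fin n)) (m : ℕ) (hm : m < n) :
    cnt a x (m + 1) = cnt a x m + if (x⁻¹ ⟨m, hm⟩ : ℕ) < a then 1 else 0 := by
  unfold cnt
  split_ifs with h
  · have : (Finset.univ.filter fun i : Fin n => (i : ℕ) < a ∧ (x i : ℕ) < m + 1) =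
      insert (x⁻¹ ⟨m, hm⟩)
        (Finset.univ.filter fun i : Fin n => (i : ℕ) < a ∧ (x i : ℕ) < m) := by
      ext i
      simp only [Finset.mem_filter, Finset.mem_univ, true_and, Finset.mem_insert]
      constructor
      · rintro ⟨h1, h2⟩
        rcases Nat.lt_succ_iff_lt_or_eq.1 h2 with h3 | h3
        · exact Or.inr ⟨h1, h3⟩
        · left
          rw [Equiv.Perm.eq_inv_iff_eq]
          exact Fin.ext h3
      · rintro (rfl | ⟨h1, h2⟩)
        · exact ⟨h, by simp⟩
        · exact ⟨h1, by omega⟩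
    rw [this, Finset.card_insert_of_notMem (by simp)]
  · rw [add_zero]
    congr 1
    ext i
    simp only [Finset.mem_filter, Finset.mem_univ, true_and]
    constructor
    · rintro ⟨h1, h2⟩
      refine ⟨h1, ?_⟩
      rcases Nat.lt_succ_iff_lt_or_eq.1 h2 with h3 | h3
      · exact h3
      · exfalso
        apply h
        have : i = x⁻¹ ⟨m, hm⟩ := by
          rw [Equiv.Perm.eq_inv_iff_eq]
          exact Fin.ext h3
        rwa [← this]
    · rintro ⟨h1, h2⟩
      exact ⟨h1, by omega⟩

lemma cnt_smul {n j : ℕ} (h : j + 1 < n) (a : ℕ) (x : Equiv.Perm (Fin n)) (m : ℕ)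
    (hm : m ≠ j + 1) : cnt a (sgen n j * x) m = cnt a x m := by
  unfold cnt
  congr 1
  ext i
  simp only [Finset.mem_filter, Finset.mem_univ, true_and, Equiv.Perm.mul_apply, sgen_val h]
  split_ifs <;> omega

lemma cnt_step {n j : ℕ} (h : j + 1 < n) (a : ℕ) (u x : Equiv.Perm (Fin n))
    (ha : asc n j h u) (hx : ∀ m, cnt a u m ≤ cnt a x m) :
    (∀ m, cnt a (sgen n j * u) m ≤ cnt a x m) ∧
    (∀ m, cnt a (sgen n j * u) m ≤ cnt a (sgen n j * x) m) := by
  have u1 := cnt_succ a (sgen n j * u) j (by omega)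
  have u2 := cnt_succ a (sgen n j * u) (j + 1) h
  have u3 := cnt_succ a u j (by omega)
  have u4 := cnt_succ a u (j + 1) h
  have x1 := cnt_succ a (sgen n j * x) j (by omega)
  have x2 := cnt_succ a (sgen n j * x) (j + 1) h
  have e1 := cnt_smul h a u j (by omega)
  have e2 := cnt_smul h a u (j + 1 + 1) (by omega)
  have e3 := cnt_smul h a x j (by omega)
  have e4 := cnt_smul h a x (j + 1 + 1) (by omega)
  rw [smul_inv_apply, sgen_left h] at u1
  rw [smul_inv_apply, sgen_right h] at u2
  have h1 := hx j
  have h2 := hx (j + 1)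
  have h3 := hx (j + 1 + 1)
  unfold asc at ha
  rw [Fin.lt_def] at ha
  constructor
  · intro m
    by_cases hm : m = j + 1
    · subst hm
      split_ifs at u1 u2 u3 u4 <;> omega
    · rw [cnt_smul h a u m hm]; exact hx m
  · intro m
    by_cases hm : m = j + 1
    · subst hm
      split_ifs at u1 u2 u3 u4 x1 x2 <;> omega
    · rw [cnt_smul h a u m hm, cnt_smul h a x m hm]; exact hx m

lemma Tinv_cnt (n a : ℕ) (l : List ℕ) (hr : Red n l) :
    ∀ m ∈ spn {x : Equiv.Perm (Fin n) | ∀ k, cnt a (1 : Equiv.Perm (Fin n)) k ≤ cnt a x k},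
      rep n (((l.map (fun j => (TU n j)⁻¹)).prod : (H n)ˣ) : H n) m ∈
        spn {x | ∀ k, cnt a (wordProd n l) k ≤ cnt a x k} := by
  induction l with
  | nil => intro m hm; simpa [wordProd] using hm
  | cons j l ih =>
    intro m hm
    obtain ⟨h1, h, ha⟩ := hr.cons
    rw [List.map_cons, List.prod_cons, Units.val_mul, map_mul, Module.End.mul_apply]
    refine spn_map _ ?_ _ (ih h1 m hm)
    intro x hx
    obtain ⟨c1, c2⟩ := cnt_step h a _ x ha hx
    rw [TU_inv h, map_smul, map_add, rep_Tg h, map_smul, map_one, wordProd_cons]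
    simp only [LinearMap.smul_apply, LinearMap.add_apply, Module.End.one_apply]
    refine Submodule.smul_mem _ _ (add_mem ?_ (Submodule.smul_mem _ _ (ee_mem c1)))
    rw [Lab_ee, ← sgen_of_lt h]
    split_ifs
    · exact ee_mem c2
    · exact add_mem (Submodule.smul_mem _ _ (ee_mem c1)) (Submodule.smul_mem _ _ (ee_mem c2))

lemma wAct_varpi {n a : ℕ} {w : Equiv.Perm (Fin n)} (h : wAct n w (varpi n a) = varpi n a) :
    sameCol a 1 w := by
  intro y
  have := congrFun h y
  unfold wAct varpi at this
  simp only [inv_one, Equiv.Perm.one_apply]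
  split_ifs at this with h1 h2 h2
  · exact ⟨fun _ => h2, fun _ => h1⟩
  · simp at this
  · simp at this
  · exact ⟨fun h3 => absurd h3 h1, fun h3 => absurd h3 h2⟩

lemma cnt_eq {n : ℕ} (a : ℕ) (x : Equiv.Perm (Fin n)) (k : ℕ) : cnt a x k =
    (Finset.univ.filter fun y : Fin n => (x⁻¹ y : ℕ) < a ∧ (y : ℕ) < k).card := by
  unfold cnt
  apply Finset.card_bij (fun i _ => x i)
  · intro i hi; simpa using hi
  · intro i _ i' _ hh; exact x.injective hh
  · intro y hy; exact ⟨x⁻¹ y, by simpa using hy, by simp⟩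

lemma sameCol_cnt {n a : ℕ} {u w : Equiv.Perm (Fin n)} (h : sameCol a u w) (k : ℕ) :
    cnt a w k = cnt a u k := by
  rw [cnt_eq, cnt_eq]
  congr 1
  ext y
  simp only [Finset.mem_filter, Finset.mem_univ, true_and, h y]

lemma Hpara_ee {n a : ℕ} {h : H n} (hh : h ∈ HparaM n (varpi n a)) :
    rep n h (ee 1) ∈ spn {x : Equiv.Perm (Fin n) | sameCol a 1 x} := by
  unfold HparaM at hh
  induction hh using Submodule.span_induction with
  | mem x hx =>
    obtain ⟨w, hw, rfl⟩ := hx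
    rw [Tw_ee_one]
    exact ee_mem (wAct_varpi hw)
  | zero => rw [map_zero]; exact zero_mem _
  | add x y _ _ hx hy => rw [map_add]; exact add_mem hx hy
  | smul c x _ hx => rw [map_smul]; exact Submodule.smul_mem _ _ hx

lemma Hpara_inj {n : ℕ} {lam : Fin n → ℤ} {h : H n} (hh : h ∈ HparaM n lam) :
    Finsupp.linearCombination HR (Tw n) (rep n h (ee 1)) = h := by
  unfold HparaM at hh
  induction hh using Submodule.span_induction with
  | mem x hx =>
    obtain ⟨w, hw, rfl⟩ := hx
    rw [Tw_ee_one]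
    unfold ee
    rw [Finsupp.linearCombination_single, one_smul]
  | zero => simp
  | add x y _ _ hx hy => rw [map_add, LinearMap.add_apply, map_add, hx, hy]
  | smul c x _ hx => rw [map_smul, LinearMap.smul_apply, map_smul, hx]

lemma colPerm_mem (n : ℕ) (C : Finset (Fin n)) (i : Fin n) :
    colPerm n C i ∈ C ↔ (i : ℕ) < C.card := by
  by_cases h : (i : ℕ) < C.card
  · simp only [h, iff_true]
    have : (finCongr ((Nat.add_sub_cancel' (col_card_le n C)).symm)) i =
        Fin.castAdd (n - C.card) ⟨i, h⟩ := by ext; simp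
    unfold colPerm
    simp only [Equiv.trans_apply]
    rw [this, finSumFinEquiv_symm_apply_castAdd]
    simp
  · simp only [h, iff_false]
    have : (finCongr ((Nat.add_sub_cancel' (col_card_le n C)).symm)) i =
        Fin.natAdd C.card ⟨i - C.card, by omega⟩ := by ext; simp; omega
    unfold colPerm
    simp only [Equiv.trans_apply]
    rw [this, finSumFinEquiv_symm_apply_natAdd]
    simp only [Equiv.sumCongr_apply, Sum.map_inr, Equiv.sumCompl_apply_inr]
    generalize (Equiv.subtypeEquivRight _) _ = z
    exact z.2

lemma colPerm_inv (n : ℕ) (C : Finset (Fin n)) (y : Fin n) :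
    ((colPerm n C)⁻¹ y : ℕ) < C.card ↔ y ∈ C := by
  rw [← colPerm_mem]; simp

end HLHecke
namespace HLHecke

/-! ### Part 5: columns and the main argument -/

lemma cnt_colPerm (n : ℕ) (C : Finset (Fin n)) (k : ℕ) :
    cnt C.card (colPerm n C) k = (C.filter fun y : Fin n => (y : ℕ) < k).card := by
  rw [cnt_eq]
  congr 1
  ext y
  simp only [Finset.mem_filter, Finset.mem_univ, true_and, colPerm_inv]

lemma nth_eq (n : ℕ) (C : Finset (Fin n)) (k : ℕ) (hk : k < C.card) :
    nth n C k = (C.orderEmbOfFin rfl ⟨k, hk⟩ : ℕ) := by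
  unfold nth
  rw [Finset.orderEmbOfFin_apply]
  rw [List.getD_eq_getElem _ _ (by simpa using hk)]
  simp

lemma nth_lower (n : ℕ) (C : Finset (Fin n)) (k : ℕ) (hk : k < C.card) :
    k + 1 ≤ (C.filter fun y : Fin n => (y : ℕ) < nth n C k + 1).card := by
  have h : ((Finset.Iic (⟨k, hk⟩ : Fin C.card)).map (C.orderEmbOfFin rfl).toEmbedding) ⊆
      C.filter fun y : Fin n => (y : ℕ) < nth n C k + 1 := by
    intro y hy
    rw [Finset.mem_map] at hy
    obtain ⟨i, hi, rfl⟩ := hy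
    rw [Finset.mem_filter, nth_eq n C k hk]
    refine ⟨Finset.orderEmbOfFin_mem _ _ _, ?_⟩
    have := (C.orderEmbOfFin rfl).monotone (Finset.mem_Iic.1 hi)
    rw [Fin.le_def] at this
    exact Nat.lt_succ_of_le this
  have := Finset.card_le_card h
  simpa using this

lemma nth_upper (n : ℕ) (C : Finset (Fin n)) (k : ℕ) (hk : k < C.card) (m : ℕ)
    (hm : m ≤ nth n C k) : (C.filter fun y : Fin n => (y : ℕ) < m).card ≤ k := by
  have h : (C.filter fun y : Fin n => (y : ℕ) < m) ⊆
      ((Finset.Iio (⟨k, hk⟩ : Fin C.card)).map (C.orderEmbOfFin rfl).toEmbedding) := by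
    intro y hy
    rw [Finset.mem_filter] at hy
    obtain ⟨hy, hym⟩ := hy
    have hr : y ∈ Set.range (C.orderEmbOfFin rfl) := by
      rw [Finset.range_orderEmbOfFin]; exact hy
    obtain ⟨i, rfl⟩ := hr
    rw [Finset.mem_map]
    refine ⟨i, ?_, rfl⟩
    rw [Finset.mem_Iio]
    rw [nth_eq n C k hk] at hm
    rw [← (C.orderEmbOfFin rfl).lt_iff_lt, Fin.lt_def]
    omega
  have := Finset.card_le_card h
  simpa using this

lemma cnt_mono {n a b : ℕ} (hab : a ≤ b) (x : Equiv.Perm (Fin n)) (m : ℕ) :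
    cnt a x m ≤ cnt b x m := by
  apply Finset.card_le_card
  intro i
  simp only [Finset.mem_filter, Finset.mem_univ, true_and]
  rintro ⟨h1, h2⟩
  exact ⟨by omega, h2⟩


/-- in the parabolic decomposition
`t^{ℓ(u_E)} (T_{u_E⁻¹})⁻¹ h = Σ_{F ∈ B(ϖ_b)} T_{u_F} h_F` of an element `h ∈ H_{n,ϖ_a}`,
the coefficient `h_F` vanishes whenever the two-column filling `F ⊗ E` is not semistandard. -/
theorem stmt9 (n a b : ℕ) (hn : 1 ≤ n) (h1 : 1 ≤ a) (hab : a ≤ b) (hbn : b ≤ n)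
    (h : H n) (hh : h ∈ HparaM n (varpi n a))
    (E : Finset (Fin n)) (hE : E.card = a)
    (g : Finset (Fin n) → H n)
    (hgmem : ∀ F : Finset (Fin n), F.card = b → g F ∈ HparaM n (varpi n b))
    (hdec : tpow n (len n (colPerm n E)) * Ring.inverse (Tw n (colPerm n E)⁻¹) * h
      = ∑ F ∈ colFinset n b, Tw n (colPerm n F) * g F)
    (F : Finset (Fin n)) (hF : F.card = b)
    (hns : ¬ pairSS n F E) :
    g F = 0 := by
  have hE1 : rep n (tpow n (len n (colPerm n E)) * Ring.inverse (Tw n (colPerm n E)⁻¹) * h)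
      (ee 1) ∈ spn {x | ∀ k, cnt a (colPerm n E) k ≤ cnt a x k} := by
    unfold tpow
    rw [mul_assoc, ← Algebra.smul_def, map_smul, LinearMap.smul_apply, map_mul,
      Module.End.mul_apply]
    refine Submodule.smul_mem _ _ ?_
    have hr := redWord_red n (colPerm n E)⁻¹
    unfold Tw
    rw [inverse_TofWord _ _ hr.1]
    have key := Tinv_cnt n a _ hr.reverse (rep n h (ee 1)) ?_
    · rw [wordProd_reverse, redWord_prod, inv_inv] at key
      exact key
    · refine Finsupp.supported_mono ?_ (Hpara_ee hh)
      intro x hx k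
      exact (sameCol_cnt hx k).ge
  have hF1 : ∀ F' : Finset (Fin n), F'.card = b → rep n (Tw n (colPerm n F') * g F') (ee 1) ∈
      spn {x | sameCol b (colPerm n F') x} := by
    intro F' hF'
    rw [map_mul, Module.End.mul_apply]
    have key := T_same n b _ (redWord_red n (colPerm n F')) _ (Hpara_ee (hgmem F' hF'))
    rw [redWord_prod] at key
    exact key
  have hz : rep n (Tw n (colPerm n F) * g F) (ee 1) = 0 := by
    ext1 x
    rw [Finsupp.zero_apply]
    by_cases hx : sameCol b (colPerm n F) x
    · have hx0 : rep n (tpow n (len n (colPerm n E)) * Ring.inverse (Tw n (colPerm n E)⁻¹) * h)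
          (ee 1) x = 0 := by
        refine (Finsupp.mem_supported' HR _).1 hE1 x ?_
        intro hxE
        unfold pairSS at hns
        push Not at hns
        obtain ⟨k, hk, hlt⟩ := hns
        have l1 := nth_lower n E k hk
        have l2 := nth_upper n F k (by omega) (nth n E k + 1) hlt
        rw [← cnt_colPerm] at l1 l2
        rw [hE] at l1
        rw [hF] at l2
        have l3 := hxE (nth n E k + 1)
        have l4 := cnt_mono hab x (nth n E k + 1)
        have l5 := sameCol_cnt hx (nth n E k + 1)
        omega
      rw [hdec, map_sum, LinearMap.sum_apply, Finsupp.finsetSum_apply,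
        Finset.sum_eq_single F] at hx0
      · exact hx0
      · intro F' hF' hne
        have hF'c : F'.card = b := by simpa [colFinset] using hF'
        refine (Finsupp.mem_supported' HR _).1 (hF1 F' hF'c) x ?_
        intro hx'
        apply hne
        ext y
        rw [← colPerm_inv, ← colPerm_inv, hF'c, hF]
        exact (hx' y).symm.trans (hx y)
      · intro hn
        exact absurd (by simp [colFinset, hF]) hn
    · exact (Finsupp.mem_supported' HR _).1 (hF1 F hF) x hx
  have hz2 : rep n (g F) (ee 1) = 0 := by
    have hu := TofWord_unit n _ (redWord_red n (colPerm n F)).1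
    unfold Tw at hz
    rw [hu] at hz
    have := congrArg (rep n ((((redWord n (colPerm n F)).map (TU n)).prod⁻¹ : (H n)ˣ) : H n)) hz
    rwa [map_zero, ← Module.End.mul_apply, ← map_mul, Units.inv_mul_cancel_left] at this
  rw [← Hpara_inj (hgmem F hF), hz2, map_zero]

end HLHecke
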